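/- Suppose q ≥ 3, r = 2m+1 is coprime to q, and m > (q+5)/2. Then the matrix R has exactly 2m − 2 nonzero entries; that is, the number of pairs (i, l) with 1 ≤ i ≤ m and 0 ≤ l ≤ m−1 such that the entry of R in row i and column l is nonzero equals 2m − 2. -/

import Mathlib

open scoped Classical

/-- The reduced index `ρ(n) = min(n % r, r − n % r)`. -/
noncomputable def rho (r n : ℕ) : ℕ := min (n % r) (r - n % r)

/-- The sign `σ(n) = (−1)^⌊n/r⌋`. -/
noncomputable def sgn (r n : ℕ) : ℤ := (-1) ^ (n / r)

/-- The entry of the matrix `R` in row (labelled) `i ∈ {1,…,m}` and column `l ∈ {0,…,m−1}`: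
column `0` is `e_1`, and for `1 ≤ l ≤ m−1` the column is the reduction of
`f_l = e_{ql+1} − A^{2pl} e_{ql−1}`. -/
noncomputable def Rent (m q : ℕ) (p : ℤ) (A : ℂ) (i l : ℕ) : ℂ :=
  if l = 0 then (if i = 1 then 1 else 0)
  else
    (if rho (2*m+1) (q*l+1) = i then ((sgn (2*m+1) (q*l+1) : ℤ) : ℂ) else 0)
      - A ^ (2 * p * (l : ℤ)) *
        (if rho (2*m+1) (q*l-1) = i then ((sgn (2*m+1) (q*l-1) : ℤ) : ℂ) else 0)

/-- The matrix `R`, with rows indexed by `i = 1,…,m` and columns by `l = 0,…,m−1`. -/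
noncomputable def Rmat (m q : ℕ) (p : ℤ) (A : ℂ) : Matrix (Fin m) (Fin m) ℂ :=
  fun i l => Rent m q p A ((i : ℕ) + 1) (l : ℕ)

theorem rho_eq_zero_iff {r n : ℕ} (hr : 0 < r) : rho r n = 0 ↔ r ∣ n := by
  have := Nat.mod_lt n hr
  rw [Nat.dvd_iff_mod_eq_zero, rho]
  omega

theorem rho_le {m n : ℕ} : rho (2 * m + 1) n ≤ m := by
  have := Nat.mod_lt n (by omega : 0 < 2 * m + 1)
  rw [rho]
  omega

theorem modEq_or_dvd_add_of_rho_eq {r a b : ℕ} (hr : 0 < r) (h : rho r a = rho r b) :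
    a ≡ b [MOD r] ∨ r ∣ a + b := by
  have ha := Nat.mod_lt a hr
  have hb := Nat.mod_lt b hr
  simp only [rho] at h
  have h' : a % r = b % r ∨ a % r + b % r = r := by omega
  refine h'.imp id fun h => ?_
  rw [Nat.dvd_iff_mod_eq_zero, Nat.add_mod, h, Nat.mod_self]

theorem sgn_cast_ne_zero (r n : ℕ) : ((sgn r n : ℤ) : ℂ) ≠ 0 := by
  simp [sgn]

theorem not_dvd_two {m : ℕ} (hm : 0 < m) : ¬ (2 * m + 1) ∣ 2 := fun h => by
  have := Nat.le_of_dvd (by norm_num) h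
  omega

/-- The indices `ρ(ql+1)` and `ρ(ql-1)` never coincide, so no cancellation occurs in a column. -/
theorem rho_succ_ne_rho_pred {m q l : ℕ} (hq : 0 < q) (hco : Nat.Coprime (2 * m + 1) q)
    (hl : 0 < l) (hlm : l < m) :
    rho (2 * m + 1) (q * l + 1) ≠ rho (2 * m + 1) (q * l - 1) := by
  intro h
  have hpos : 0 < q * l := Nat.mul_pos hq hl
  rcases modEq_or_dvd_add_of_rho_eq (by omega) h with h | h
  · have h2 := (Nat.modEq_iff_dvd' (by omega : q * l - 1 ≤ q * l + 1)).1 h.symm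
    rw [show q * l + 1 - (q * l - 1) = 2 by omega] at h2
    exact not_dvd_two (by omega) h2
  · rw [show q * l + 1 + (q * l - 1) = q * (2 * l) by rw [mul_left_comm]; omega] at h
    have := Nat.le_of_dvd (by omega) (hco.dvd_of_dvd_mul_left h)
    omega

theorem Rent_ne_zero_iff {m q i l : ℕ} {p : ℤ} {A : ℂ} (hA : A ≠ 0) (hl : l ≠ 0)
    (hne : rho (2 * m + 1) (q * l + 1) ≠ rho (2 * m + 1) (q * l - 1)) :
    Rent m q p A i l ≠ 0 ↔
      i = rho (2 * m + 1) (q * l + 1) ∨ i = rho (2 * m + 1) (q * l - 1) := by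
  have hz : A ^ (2 * p * (l : ℤ)) ≠ 0 := zpow_ne_zero _ hA
  rw [Rent, if_neg hl, eq_comm (a := i), eq_comm (a := i)]
  by_cases h1 : rho (2 * m + 1) (q * l + 1) = i
  · have h2 : rho (2 * m + 1) (q * l - 1) ≠ i := fun h => hne (h1.trans h.symm)
    simp only [if_neg h2, mul_zero, sub_zero, h1, true_or, iff_true]
    exact sgn_cast_ne_zero _ _
  · by_cases h2 : rho (2 * m + 1) (q * l - 1) = i
    · simp only [if_neg h1, zero_sub, h2, or_true, iff_true]
      exact neg_ne_zero.2 (mul_ne_zero hz (sgn_cast_ne_zero _ _))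
    · simp [h1, h2]

theorem card_filter_Icc_eq_or_eq {m a b : ℕ} (ha : a ≤ m) (hb : b ≤ m) (hab : a ≠ b) :
    ((Finset.Icc 1 m).filter fun i => i = a ∨ i = b).card + (if a = 0 ∨ b = 0 then 1 else 0)
      = 2 := by
  have h : ((Finset.Icc 1 m).filter fun i => i = a ∨ i = b) = ({a, b} : Finset ℕ).erase 0 := by
    ext i
    simp only [Finset.mem_filter, Finset.mem_Icc, Finset.mem_erase, Finset.mem_insert,
      Finset.mem_singleton]
    omega
  rw [h]
  split_ifs with h0
  · rw [Finset.card_erase_of_mem (by simpa [eq_comm] using h0), Finset.card_pair hab]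
  · rw [Finset.erase_eq_of_notMem (by simpa [eq_comm] using h0), Finset.card_pair hab]

theorem exists_dvd_mul_add_one_or_sub_one {m q : ℕ} (hm : 0 < m) (hq : 3 ≤ q)
    (hco : Nat.Coprime (2 * m + 1) q) (hmq : q + 5 < 2 * m) :
    ∃ l, 0 < l ∧ l < m ∧ ((2 * m + 1) ∣ q * l + 1 ∨ (2 * m + 1) ∣ q * l - 1) := by
  obtain ⟨a, ha, h⟩ := Nat.exists_mul_mod_eq_one_of_coprime hco.symm (by omega)
  have ha0 : 0 < a := Nat.pos_of_ne_zero (by rintro rfl; simp at h)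
  have hdvd : (2 * m + 1) ∣ q * a - 1 := by
    have := Nat.dvd_sub_mod (n := 2 * m + 1) (q * a)
    rwa [h] at this
  have hqa : 0 < q * a := by positivity
  rw [← Int.natCast_dvd_natCast, Nat.cast_sub hqa] at hdvd
  push_cast at hdvd
  obtain ⟨k, hk⟩ := hdvd
  rcases lt_trichotomy a m with hlt | rfl | hgt
  · refine ⟨a, ha0, hlt, .inr ?_⟩
    rw [← Int.natCast_dvd_natCast, Nat.cast_sub hqa]
    push_cast
    exact ⟨k, hk⟩
  · have : ((2 * a + 1 : ℕ) : ℤ) ∣ ((q + 2 : ℕ) : ℤ) := ⟨q - 2 * k, by push_cast; linarith⟩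
    have := Nat.le_of_dvd (by omega) (Int.natCast_dvd_natCast.1 this)
    omega
  · by_cases he : a = m + 1
    · subst he
      have : ((2 * m + 1 : ℕ) : ℤ) ∣ ((q - 2 : ℕ) : ℤ) :=
        ⟨2 * k - q, by push_cast [Nat.cast_sub (by omega : 2 ≤ q)] at hk ⊢; linarith⟩
      have := Nat.le_of_dvd (by omega) (Int.natCast_dvd_natCast.1 this)
      omega
    · refine ⟨2 * m + 1 - a, by omega, by omega, .inl ?_⟩
      rw [← Int.natCast_dvd_natCast]
      push_cast [Nat.cast_sub ha.le]
      exact ⟨q - k, by linarith⟩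

theorem eq_of_dvd_mul_add_one_or_sub_one {m q l l' : ℕ} (hq : 0 < q)
    (hco : Nat.Coprime (2 * m + 1) q) (hl : 0 < l) (hlm : l < m) (hl' : 0 < l') (hlm' : l' < m)
    (h : (2 * m + 1) ∣ q * l + 1 ∨ (2 * m + 1) ∣ q * l - 1)
    (h' : (2 * m + 1) ∣ q * l' + 1 ∨ (2 * m + 1) ∣ q * l' - 1) : l = l' := by
  have hp : 1 ≤ q * l := Nat.mul_pos hq hl
  have hp' : 1 ≤ q * l' := Nat.mul_pos hq hl'
  have hco' : IsCoprime ((2 * m + 1 : ℕ) : ℤ) (q : ℤ) := Nat.isCoprime_iff_coprime.2 hco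
  have key : ((2 * m + 1 : ℕ) : ℤ) ∣ (l - l' : ℤ) ∨ ((2 * m + 1 : ℕ) : ℤ) ∣ (l + l' : ℤ) := by
    simp only [← Int.natCast_dvd_natCast, Nat.cast_sub hp, Nat.cast_sub hp',
      Nat.cast_add, Nat.cast_mul, Nat.cast_one] at h h'
    push_cast at h h' hco' ⊢
    rcases h with h | h <;> rcases h' with h' | h'
    · exact .inl (hco'.dvd_of_dvd_mul_left (by convert dvd_sub h h' using 1; ring))
    · exact .inr (hco'.dvd_of_dvd_mul_left (by convert dvd_add h h' using 1; ring))
    · exact .inr (hco'.dvd_of_dvd_mul_left (by convert dvd_add h h' using 1; ring))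
    · exact .inl (hco'.dvd_of_dvd_mul_left (by convert dvd_sub h h' using 1; ring))
  rcases key with h | h
  · have := Int.eq_zero_of_abs_lt_dvd h (abs_lt.2 (by omega))
    omega
  · have := Int.le_of_dvd (by omega) h
    omega

/-- For `q ≥ 3`, `r = 2m+1` coprime to `q`, and `m > (q+5)/2`, the matrix `R` has
exactly `2m − 2` nonzero entries. -/
theorem stmt_18 (m q : ℕ) (hm : 0 < m) (hq : 3 ≤ q)
    (hco : Nat.Coprime (2*m+1) q) (hmq : q + 5 < 2*m) (p : ℤ) (A : ℂ)
    (hA : IsPrimitiveRoot A (2*(2*m+1))) :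
    (((Finset.Icc 1 m) ×ˢ (Finset.range m)).filter
      (fun il : ℕ × ℕ => Rent m q p A il.1 il.2 ≠ 0)).card = 2*m - 2 := by
  have hA0 : A ≠ 0 := hA.ne_zero (by omega)
  obtain ⟨l₀, hl₀, hlm₀, hd₀⟩ := exists_dvd_mul_add_one_or_sub_one hm hq hco hmq
  have hcol : ∀ l ∈ Finset.Ico 1 m,
      ((Finset.Icc 1 m).filter fun i => Rent m q p A i l ≠ 0).card + (if l = l₀ then 1 else 0)
        = 2 := by
    intro l hl
    rw [Finset.mem_Ico] at hl
    have hne := rho_succ_ne_rho_pred (by omega) hco (by omega : 0 < l) hl.2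
    have hbad : l = l₀ ↔
        rho (2 * m + 1) (q * l + 1) = 0 ∨ rho (2 * m + 1) (q * l - 1) = 0 := by
      rw [rho_eq_zero_iff (by omega), rho_eq_zero_iff (by omega)]
      refine ⟨fun h => h ▸ hd₀, fun h => ?_⟩
      exact eq_of_dvd_mul_add_one_or_sub_one (by omega) hco (by omega) hl.2 hl₀ hlm₀ h hd₀
    simp only [Rent_ne_zero_iff hA0 (by omega : l ≠ 0) hne, hbad]
    convert card_filter_Icc_eq_or_eq rho_le rho_le hne
  have hzero : ((Finset.Icc 1 m).filter fun i => Rent m q p A i 0 ≠ 0).card = 1 := by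
    rw [Finset.card_eq_one]
    refine ⟨1, ?_⟩
    ext i
    simp only [Rent, Finset.mem_filter, Finset.mem_Icc, Finset.mem_singleton]
    by_cases hi : i = 1 <;> simp [hi]
    omega
  have hsum := Finset.sum_congr rfl hcol
  rw [Finset.sum_add_distrib, Finset.sum_ite_eq', if_pos (Finset.mem_Ico.2 ⟨hl₀, hlm₀⟩),
    Finset.sum_const, Nat.card_Ico, smul_eq_mul] at hsum
  rw [Finset.card_filter, Finset.sum_product_right]
  simp only [← Finset.card_filter]
  rw [Finset.range_eq_Ico, Finset.sum_eq_sum_Ico_succ_bot hm, hzero]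
  simp only [zero_add]
  omega
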